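/- Let Γ be a finitely generated group and Γ₀ a finitely generated normal subgroup of Γ. Let ρ₁, ρ₂ : Γ → PSL(2,ℂ) be strictly irreducible homomorphisms whose images are not isomorphic to the alternating group A₄ or to the symmetric group S₄. If the restrictions ρ₁|Γ₀ and ρ₂|Γ₀ are irreducible and conjugate in PSL(2,ℂ) (equivalently, have equal characters), then ρ₁ and ρ₂ are conjugate in PSL(2,ℂ) (equivalently, have equal characters). -/

import Mathlib

noncomputable section

/-- `SL(2,ℂ)`. -/
abbrev SL2C : Type := Matrix.SpecialLinearGroup (Fin 2) ℂ

/-- `PSL(2,ℂ)`, the quotient of `SL(2,ℂ)` by its center `{±I}`. -/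
abbrev PSL2C : Type := SL2C ⧸ Subgroup.center SL2C

/-- The canonical projection `SL(2,ℂ) → PSL(2,ℂ)`. -/
def projPSL : SL2C →* PSL2C := QuotientGroup.mk' (Subgroup.center SL2C)

/-- A homomorphism into `PSL(2,ℂ)` is reducible if some nonzero `v ∈ ℂ²` is an eigenvector of
every matrix representing an element of the image. -/
def IsReducibleRep {Γ : Type*} [Group Γ] (ρ : Γ →* PSL2C) : Prop :=
  ∃ v : Fin 2 → ℂ, v ≠ 0 ∧ ∀ (γ : Γ) (M : SL2C), projPSL M = ρ γ →
    ∃ c : ℂ, Matrix.mulVec (M : Matrix (Fin 2) (Fin 2) ℂ) v = c • v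

/-- The subgroup `𝒩 ⊆ PSL(2,ℂ)` of classes of matrices that are either diagonal or have both
diagonal entries `0`, as a set. -/
def NNset : Set PSL2C :=
  {x | ∃ M : SL2C, projPSL M = x ∧
    (((M : Matrix (Fin 2) (Fin 2) ℂ) 0 1 = 0 ∧ (M : Matrix (Fin 2) (Fin 2) ℂ) 1 0 = 0) ∨
     ((M : Matrix (Fin 2) (Fin 2) ℂ) 0 0 = 0 ∧ (M : Matrix (Fin 2) (Fin 2) ℂ) 1 1 = 0))}

/-- Strictly irreducible: irreducible and no conjugate has image contained in `𝒩`. -/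
def IsStrictlyIrreducibleRep {Γ : Type*} [Group Γ] (ρ : Γ →* PSL2C) : Prop :=
  ¬ IsReducibleRep ρ ∧ ∀ B : PSL2C, ¬ (∀ γ : Γ, B * ρ γ * B⁻¹ ∈ NNset)

theorem aux_perm3 : ∀ (σ : Equiv.Perm (Fin 3)) (v : Fin 3), σ ^ 3 = 1 → σ v = v → σ = 1 := by
  decide

theorem aux_perm3' {S : Type*} (hS : Nat.card S = 3) (σ : Equiv.Perm S) (v : S)
    (h3 : σ ^ 3 = 1) (hv : σ v = v) : σ = 1 := by
  have : Finite S := Nat.finite_of_card_ne_zero (by omega)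
  let e : S ≃ Fin 3 := (Finite.equivFin S).trans (finCongr hS)
  have h := aux_perm3 (e.permCongrHom σ) (e v) (by rw [← map_pow, h3, map_one])
    (by simp [Equiv.permCongrHom, hv])
  exact e.permCongrHom.injective (h.trans (map_one _).symm)

theorem aux_four (n : ℕ) (h : n ∣ 8) (h1 : n ≡ 1 [MOD 3]) (h2 : 12 ≤ Nat.factorial n) : n = 4 := by
  have h8 := Nat.le_of_dvd (by norm_num) h
  unfold Nat.ModEq at h1
  have h3 : n = 1 ∨ n = 4 ∨ n = 7 := by omega
  rcases h3 with rfl | rfl | rfl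
  · norm_num at h2
  · rfl
  · norm_num at h

/-- The set of nontrivial elements of a subgroup. -/
def NontrivElts {K : Type*} [Group K] (V : Subgroup K) : Type _ := {v : K // v ∈ V ∧ v ≠ 1}

instance conjActNontriv {K : Type*} [Group K] (V : Subgroup K) [hN : V.Normal] :
    MulAction K (NontrivElts V) where
  smul g v := ⟨g * v.1 * g⁻¹, hN.conj_mem _ v.2.1 g, by
    intro h
    apply v.2.2
    rw [mul_inv_eq_one] at h
    simpa using h⟩
  one_smul v := Subtype.ext (by
    show (1 : K) * v.1 * 1⁻¹ = v.1
    simp)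
  mul_smul a b v := Subtype.ext (by
    show (a * b) * v.1 * (a * b)⁻¹ = a * (b * v.1 * b⁻¹) * a⁻¹
    group)

theorem conjAct_val {K : Type*} [Group K] (V : Subgroup K) [V.Normal] (g : K)
    (v : NontrivElts V) : (g • v).1 = g * v.1 * g⁻¹ := rfl

theorem card_nontriv {K : Type*} [Group K] (V : Subgroup K) (hV : Nat.card V = 4) :
    Nat.card (NontrivElts V) = 3 := by
  have : Finite V := Nat.finite_of_card_ne_zero (by omega)
  have e : NontrivElts V ≃ {v : V // v ≠ 1} :=
    { toFun := fun v => ⟨⟨v.1, v.2.1⟩, fun h => v.2.2 (congrArg Subtype.val h)⟩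
      invFun := fun v => ⟨v.1.1, v.1.2, fun h => v.2 (Subtype.ext h)⟩
      left_inv := fun v => rfl
      right_inv := fun v => rfl }
  rw [Nat.card_congr e]
  classical
  have := Fintype.ofFinite V
  rw [Nat.card_eq_fintype_card, Fintype.card_subtype_compl]
  rw [Nat.card_eq_fintype_card] at hV
  simp [hV]

theorem ker_conjAct {K : Type*} [Group K] (V : Subgroup K) [V.Normal]
    (hc : ∀ x ∈ V, ∀ y ∈ V, x * y = y * x)
    (hcent : ∀ g : K, (∀ v ∈ V, g * v = v * g) → g ∈ V) :
    (MulAction.toPermHom K (NontrivElts V)).ker = V := by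
  ext g
  rw [MonoidHom.mem_ker]
  constructor
  · intro h
    apply hcent
    intro v hv
    by_cases h1 : v = 1
    · simp [h1]
    have := congrArg Subtype.val (Equiv.Perm.congr_fun h (⟨v, hv, h1⟩ : NontrivElts V))
    have h2 : g * v * g⁻¹ = v := this
    exact mul_inv_eq_iff_eq_mul.1 h2
  · intro hg
    ext1 v
    apply Subtype.ext
    show g * v.1 * g⁻¹ = v.1
    rw [mul_inv_eq_iff_eq_mul]
    exact hc _ hg _ v.2.1

theorem groupA {K : Type*} [Group K] (V : Subgroup K) [V.Normal] (hV : Nat.card V = 4)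
    (h2 : ∀ v ∈ V, v * v = 1)
    (hcent : ∀ g : K, (∀ v ∈ V, g * v = v * g) → g ∈ V)
    (hno : ∀ u ∈ V, (∀ g : K, g * u = u * g) → u = 1) :
    Nonempty (K ≃* alternatingGroup (Fin 4)) ∨ Nonempty (K ≃* Equiv.Perm (Fin 4)) := by
  have hc : ∀ x ∈ V, ∀ y ∈ V, x * y = y * x := by
    intro x hx y hy
    have hxy := h2 _ (V.mul_mem hx hy)
    have h1 := eq_inv_of_mul_eq_one_left hxy
    rw [mul_inv_rev, ← eq_inv_of_mul_eq_one_left (h2 x hx),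
      ← eq_inv_of_mul_eq_one_left (h2 y hy)] at h1
    exact h1
  have hS := card_nontriv V hV
  have hfS : Finite (NontrivElts V) := Nat.finite_of_card_ne_zero (by omega)
  have hfV : Finite V := Nat.finite_of_card_ne_zero (by omega)
  set ψ := MulAction.toPermHom K (NontrivElts V) with hψ
  have hker : ψ.ker = V := ker_conjAct V hc hcent
  have hcardK : Nat.card K = 4 * Nat.card ψ.range := by
    rw [← Subgroup.card_mul_index ψ.ker, Subgroup.index_ker, hker, hV]
  have hfK : Finite K := Nat.finite_of_card_ne_zero (by
    rw [hcardK]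
    have : Nat.card ψ.range ≠ 0 := Nat.card_pos.ne'
    omega)
  have hR6 : Nat.card ψ.range ∣ 6 := by
    have := Subgroup.card_subgroup_dvd_card ψ.range
    rw [Nat.card_perm, hS] at this
    exact this
  have hRle := Nat.le_of_dvd (by norm_num) hR6
  -- three divides
  have h3 : 3 ∣ Nat.card ψ.range := by
    by_contra h3
    have h2p : IsPGroup 2 K := by
      have : Nat.card ψ.range = 1 ∨ Nat.card ψ.range = 2 := by
        generalize Nat.card ψ.range = m at *
        interval_cases m <;> omega
      rcases this with h | h
      · exact IsPGroup.of_card (n := 2) (by rw [hcardK, h]; norm_num)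
      · exact IsPGroup.of_card (n := 3) (by rw [hcardK, h]; norm_num)
    have : Fact (Nat.Prime 2) := ⟨Nat.prime_two⟩
    obtain ⟨u, hu⟩ := h2p.nonempty_fixed_point_of_prime_not_dvd_card (NontrivElts V)
      (by rw [hS]; norm_num)
    apply u.2.2
    apply hno _ u.2.1
    intro g
    exact mul_inv_eq_iff_eq_mul.1 (congrArg Subtype.val (hu g))
  have hK : Nat.card K = 12 ∨ Nat.card K = 24 := by
    rw [hcardK]
    generalize Nat.card ψ.range = m at *
    interval_cases m <;> omega
  have : Fact (Nat.Prime 3) := ⟨Nat.prime_three⟩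
  -- sylow elements
  have hP3 : ∀ (P : Sylow 3 K), Nat.card P = 3 := by
    intro P
    have hfac := P.card_eq_multiplicity
    have : (Nat.card K).factorization 3 = 1 := by
      rcases hK with h | h <;> rw [h]
      · rw [show 12 = 3 ^ 1 * 4 by norm_num, Nat.factorization_mul (by norm_num) (by norm_num)]
        rw [Nat.Prime.factorization_pow Nat.prime_three]
        simp [Nat.factorization_eq_zero_of_not_dvd (show ¬ 3 ∣ 4 by norm_num)]
      · rw [show 24 = 3 ^ 1 * 8 by norm_num, Nat.factorization_mul (by norm_num) (by norm_num)]
        rw [Nat.Prime.factorization_pow Nat.prime_three]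
        simp [Nat.factorization_eq_zero_of_not_dvd (show ¬ 3 ∣ 8 by norm_num)]
    rw [this] at hfac
    exact hfac
  have hfree : ∀ p : K, p ^ 3 = 1 → ∀ v ∈ V, v ≠ 1 → p * v = v * p → p = 1 := by
    intro p hp v hv hv1 hpv
    have h1 : ψ p = 1 := by
      apply aux_perm3' hS (ψ p) ⟨v, hv, hv1⟩
      · rw [← map_pow, hp, map_one]
      · apply Subtype.ext
        show p * v * p⁻¹ = v
        rw [hpv]; group
    have h4 : p ∈ V := by rw [← hker]; exact h1
    have h5 := h2 p h4
    rw [pow_succ, pow_two, h5, one_mul] at hp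
    exact hp
  let θ := MulAction.toPermHom K (Sylow 3 K)
  have hnorm : ∀ g ∈ θ.ker, ∀ P : Sylow 3 K, ∀ p ∈ P, g * p * g⁻¹ ∈ P := by
    intro g hg P p hp
    have h1 : g • P = P := Equiv.Perm.congr_fun (MonoidHom.mem_ker.1 hg) P
    have h2 := Sylow.smul_eq_iff_mem_normalizer.1 h1
    exact (Subgroup.mem_normalizer_iff.1 h2 p).1 hp
  have hVker : ∀ v ∈ V, v ∈ θ.ker → v = 1 := by
    intro v hv hvk
    by_contra hv1
    obtain ⟨P⟩ : Nonempty (Sylow 3 K) := inferInstance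
    have hPc := hP3 P
    have hone : ∀ p ∈ P, p ^ 3 = 1 := by
      intro p hp
      have := pow_card_eq_one' (x := (⟨p, hp⟩ : (P : Subgroup K)))
      rw [hPc] at this
      exact congrArg Subtype.val this
    have htriv : ∀ p ∈ P, p = 1 := by
      intro p hp
      apply hfree p (hone p hp) v hv hv1
      have ha : v * p * v⁻¹ * p⁻¹ ∈ P := P.mul_mem (hnorm v hvk P p hp) (P.inv_mem hp)
      have hb : v * p * v⁻¹ * p⁻¹ ∈ V := by
        have := V.mul_mem hv ((inferInstance : V.Normal).conj_mem _ (V.inv_mem hv) p)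
        convert this using 1
        group
      have hc1 := hone _ ha
      rw [pow_succ, pow_two, h2 _ hb, one_mul, mul_inv_eq_one, mul_inv_eq_iff_eq_mul] at hc1
      exact hc1.symm
    have : Nat.card P = 1 := by
      rw [Nat.card_eq_one_iff_unique]
      exact ⟨⟨fun a b => Subtype.ext ((htriv _ a.2).trans (htriv _ b.2).symm)⟩, ⟨1⟩⟩
    omega
  have hθ : Function.Injective θ := by
    rw [← MonoidHom.ker_eq_bot_iff, eq_bot_iff]
    intro g hg
    rw [Subgroup.mem_bot]
    apply hVker g _ hg
    apply hcent
    intro v hv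
    have ha : g * v * g⁻¹ * v⁻¹ ∈ V :=
      V.mul_mem ((inferInstance : V.Normal).conj_mem _ hv g) (V.inv_mem hv)
    have hb : g * v * g⁻¹ * v⁻¹ ∈ θ.ker := by
      have := θ.ker.mul_mem hg ((inferInstance : θ.ker.Normal).conj_mem _ (θ.ker.inv_mem hg) v)
      convert this using 1
      group
    have := hVker _ ha hb
    rwa [mul_inv_eq_one, mul_inv_eq_iff_eq_mul] at this
  have hn4 : Nat.card (Sylow 3 K) = 4 := by
    obtain ⟨P⟩ : Nonempty (Sylow 3 K) := inferInstance
    have h1 := card_sylow_modEq_one 3 K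
    have h2 := P.card_dvd_index
    have h3 := Subgroup.card_mul_index (P : Subgroup K)
    have h4 : Nat.card (P : Subgroup K) = 3 := hP3 P
    rw [h4] at h3
    have h5 : Nat.card K ≤ Nat.card (Equiv.Perm (Sylow 3 K)) :=
      Nat.card_le_card_of_injective _ hθ
    rw [Nat.card_perm] at h5
    have h6 : (P : Subgroup K).index = 4 ∨ (P : Subgroup K).index = 8 := by omega
    have h7 : Nat.card (Sylow 3 K) ∣ 8 := by
      rcases h6 with h | h <;> rw [h] at h2
      · exact h2.trans (by norm_num)
      · exact h2
    exact aux_four _ h7 h1 (by omega)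
  let e : Sylow 3 K ≃ Fin 4 := (Finite.equivFin _).trans (finCongr hn4)
  let Φ : K →* Equiv.Perm (Fin 4) := e.permCongrHom.toMonoidHom.comp θ
  have hΦ : Function.Injective Φ := e.permCongrHom.injective.comp hθ
  let iso : K ≃* Φ.range := MonoidHom.ofInjective hΦ
  have hci : Nat.card Φ.range = Nat.card K := (Nat.card_congr iso.toEquiv).symm
  have hidx := Subgroup.card_mul_index Φ.range
  rw [hci, Nat.card_perm, Nat.card_fin] at hidx
  have h24 : Nat.factorial 4 = 24 := rfl
  rw [h24] at hidx
  rcases hK with h | h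
  · left
    have : Φ.range.index = 2 := by rw [h] at hidx; omega
    have := Equiv.Perm.eq_alternatingGroup_of_index_eq_two this
    exact ⟨iso.trans (MulEquiv.subgroupCongr this)⟩
  · right
    have : Φ.range.index = 1 := by rw [h] at hidx; omega
    have := Subgroup.index_eq_one.1 this
    exact ⟨(iso.trans (MulEquiv.subgroupCongr this)).trans Subgroup.topEquiv⟩

theorem mat_eq_iff (A B : Matrix (Fin 2) (Fin 2) ℂ) : A = B ↔
    A 0 0 = B 0 0 ∧ A 0 1 = B 0 1 ∧ A 1 0 = B 1 0 ∧ A 1 1 = B 1 1 := by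
  constructor
  · rintro rfl; simp
  · rintro ⟨a, b, c, d⟩
    ext i j
    fin_cases i <;> fin_cases j <;> assumption

theorem proj_eq (A B : SL2C) : projPSL A = projPSL B ↔
    (A : Matrix (Fin 2) (Fin 2) ℂ) = B ∨ (A : Matrix (Fin 2) (Fin 2) ℂ) = -B := by
  unfold projPSL
  rw [QuotientGroup.mk'_apply, QuotientGroup.mk'_apply, eq_comm, QuotientGroup.eq,
    Matrix.SpecialLinearGroup.mem_center_iff]
  constructor
  · rintro ⟨r, hr, h⟩
    have hA : A = B * (B⁻¹ * A) := by group
    have hA' : (A : Matrix (Fin 2) (Fin 2) ℂ) = B * Matrix.scalar (Fin 2) r := by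
      rw [h, ← Matrix.SpecialLinearGroup.coe_mul, ← hA]
    rw [Fintype.card_fin] at hr
    rcases (show r = 1 ∨ r = -1 by simpa using hr) with rfl | rfl
    · left; simpa using hA'
    · right; rw [hA', map_neg, map_one, mul_neg, mul_one]
  · rintro (h | h)
    · refine ⟨1, by simp, ?_⟩
      have : A = B := Subtype.ext h
      simp [this]
    · refine ⟨-1, by simp, ?_⟩
      have : A = -B := Subtype.ext h
      rw [mat_eq_iff]
      simp [this]

theorem proj_surj (x : PSL2C) : ∃ M : SL2C, projPSL M = x :=
  QuotientGroup.mk'_surjective _ x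

/-- Two lifts of commuting elements commute up to sign. -/
theorem comm_lift (A B : SL2C) (h : projPSL A * projPSL B = projPSL B * projPSL A) :
    (A : Matrix (Fin 2) (Fin 2) ℂ) * B = B * A ∨
    (A : Matrix (Fin 2) (Fin 2) ℂ) * B = -(B * A : Matrix (Fin 2) (Fin 2) ℂ) := by
  rw [← map_mul, ← map_mul, proj_eq] at h
  simpa using h

theorem det_entries (A : SL2C) : (A : Matrix (Fin 2) (Fin 2) ℂ) 0 0 * A 1 1 - A 0 1 * A 1 0 = 1 := by
  rw [← Matrix.det_fin_two]; exact A.2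

/-- The class is trivial iff the lift is scalar. -/
theorem proj_one (A : SL2C) : projPSL A = 1 ↔
    (A : Matrix (Fin 2) (Fin 2) ℂ) = 1 ∨ (A : Matrix (Fin 2) (Fin 2) ℂ) = -1 := by
  rw [← map_one projPSL, proj_eq]; simp

theorem proj_one_of_scalar (A : SL2C) (h01 : A 0 1 = 0) (h10 : A 1 0 = 0) (hd : A 0 0 = A 1 1) :
    projPSL A = 1 := by
  rw [proj_one]
  have hdet := det_entries A
  rw [h01, hd] at hdet
  have : (A 1 1 - 1) * (A 1 1 + 1) = 0 := by linear_combination hdet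
  rcases mul_eq_zero.1 this with h | h
  · left
    rw [mat_eq_iff]
    simp [h01, h10, hd]
    linear_combination h
  · right
    rw [mat_eq_iff]
    simp [h01, h10, hd]
    linear_combination h

theorem trace_zero_of_invol (A : SL2C) (h1 : projPSL A ≠ 1) (h2 : projPSL A * projPSL A = 1) :
    A 1 1 = - A 0 0 := by
  rw [← map_mul, proj_one] at h2
  have hdet := det_entries A
  simp only [mat_eq_iff, Matrix.SpecialLinearGroup.coe_mul, Matrix.mul_apply, Fin.sum_univ_two,
    Matrix.neg_apply, Matrix.one_apply_eq, Matrix.one_apply_ne, ne_eq, zero_ne_one, one_ne_zero,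
    not_false_eq_true, neg_zero] at h2
  by_contra hne
  have ht : A 0 0 + A 1 1 ≠ 0 := fun h => hne (by linear_combination h)
  apply h1
  rcases h2 with ⟨a, b, c, d⟩ | ⟨a, b, c, d⟩
  all_goals
    have hb : A 0 1 = 0 := by
      apply (mul_eq_zero.1 (show (A 0 0 + A 1 1) * A 0 1 = 0 by linear_combination b)).resolve_left ht
    have hc : A 1 0 = 0 := by
      apply (mul_eq_zero.1 (show (A 0 0 + A 1 1) * A 1 0 = 0 by linear_combination c)).resolve_left ht
    refine proj_one_of_scalar A hb hc ?_
    apply sub_eq_zero.1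
    apply (mul_eq_zero.1 (show (A 0 0 + A 1 1) * (A 0 0 - A 1 1) = 0 by
      linear_combination a - d)).resolve_left ht

theorem invol_of_trace_zero (A : SL2C) (h : A 1 1 = - A 0 0) : projPSL A * projPSL A = 1 := by
  rw [← map_mul, proj_one]
  right
  have hdet := det_entries A
  rw [h] at hdet
  rw [mat_eq_iff]
  simp only [Matrix.SpecialLinearGroup.coe_mul, Matrix.mul_apply, Fin.sum_univ_two,
    Matrix.neg_apply, Matrix.one_apply_eq, Matrix.one_apply_ne, ne_eq, zero_ne_one, one_ne_zero,
    not_false_eq_true, neg_zero]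
  rw [h]
  refine ⟨?_, ?_, ?_, ?_⟩
  · linear_combination -hdet
  · ring
  · ring
  · linear_combination -hdet

theorem trace_zero_of_anti (A M : SL2C)
    (h : (A : Matrix (Fin 2) (Fin 2) ℂ) * M = -(M * A : Matrix (Fin 2) (Fin 2) ℂ)) :
    A 1 1 = - A 0 0 := by
  have hA : (A : Matrix (Fin 2) (Fin 2) ℂ) =
      -((M : Matrix (Fin 2) (Fin 2) ℂ) * A * (M⁻¹ : SL2C)) := by
    rw [← neg_mul, ← h, mul_assoc, ← Matrix.SpecialLinearGroup.coe_mul]; simp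
  have ht := congrArg Matrix.trace hA
  rw [Matrix.trace_neg, Matrix.trace_mul_comm, ← mul_assoc, ← Matrix.SpecialLinearGroup.coe_mul,
    inv_mul_cancel, Matrix.SpecialLinearGroup.coe_one, one_mul, Matrix.trace_fin_two] at ht
  linear_combination ht / 2

theorem exists_eigvec (A : Matrix (Fin 2) (Fin 2) ℂ) :
    ∃ (v : Fin 2 → ℂ) (c : ℂ), v ≠ 0 ∧ A.mulVec v = c • v := by
  obtain ⟨c, hc⟩ := Module.End.exists_eigenvalue (Matrix.toLin' A)
  obtain ⟨v, hv⟩ := hc.exists_hasEigenvector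
  exact ⟨v, c, hv.2, by simpa using hv.apply_eq_smul⟩

theorem parallel (u v : Fin 2 → ℂ) (hv : v ≠ 0) (h : v 0 * u 1 = v 1 * u 0) :
    ∃ c : ℂ, u = c • v := by
  by_cases h0 : v 0 = 0
  · have h1 : v 1 ≠ 0 := by
      intro h1; apply hv; ext i; fin_cases i <;> simp [h0, h1]
    refine ⟨u 1 / v 1, ?_⟩
    have : u 0 = 0 := by
      rw [h0, zero_mul] at h
      exact (mul_eq_zero.1 h.symm).resolve_left h1
    ext i; fin_cases i
    · simp [h0, this]
    · simp [h1]
  · refine ⟨u 0 / v 0, ?_⟩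
    ext i; fin_cases i
    · simp [h0]
    · simp
      field_simp
      linear_combination h

theorem eig_of_comm (A M : SL2C) (hA : projPSL A ≠ 1)
    (h : (A : Matrix (Fin 2) (Fin 2) ℂ) * M = M * A) (v : Fin 2 → ℂ) (c : ℂ) (hv : v ≠ 0)
    (hvc : (A : Matrix (Fin 2) (Fin 2) ℂ).mulVec v = c • v) :
    ∃ d : ℂ, (M : Matrix (Fin 2) (Fin 2) ℂ).mulVec v = d • v := by
  apply parallel _ _ hv
  set u := (M : Matrix (Fin 2) (Fin 2) ℂ).mulVec v with hu
  have huc : (A : Matrix (Fin 2) (Fin 2) ℂ).mulVec u = c • u := by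
    rw [hu, Matrix.mulVec_mulVec, h, ← Matrix.mulVec_mulVec, hvc, Matrix.mulVec_smul]
  clear_value u
  have e1 := congrFun hvc 0
  have e2 := congrFun hvc 1
  have e3 := congrFun huc 0
  have e4 := congrFun huc 1
  simp only [Matrix.mulVec, dotProduct, Fin.sum_univ_two, Pi.smul_apply, smul_eq_mul] at e1 e2 e3 e4
  by_contra hne
  have hD : v 0 * u 1 - v 1 * u 0 ≠ 0 := fun h => hne (sub_eq_zero.1 h)
  apply hA
  have key : ∀ x : ℂ, (v 0 * u 1 - v 1 * u 0) * x = 0 → x = 0 := fun x hx =>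
    (mul_eq_zero.1 hx).resolve_left hD
  have k1 : A 0 1 = 0 := key _ (by linear_combination v 0 * e3 - u 0 * e1)
  have k2 : A 1 0 = 0 := key _ (by linear_combination u 1 * e2 - v 1 * e4)
  have k3 : A 0 0 - c = 0 := key _ (by linear_combination u 1 * e1 - v 1 * e3)
  have k4 : A 1 1 - c = 0 := key _ (by linear_combination v 0 * e4 - u 0 * e2)
  exact proj_one_of_scalar A k1 k2 (by linear_combination k3 - k4)

/-- M1 -/
theorem invol_of_centralize {Γ : Type*} [Group Γ] (ρ : Γ →* PSL2C) (hirr : ¬ IsReducibleRep ρ)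
    (z : PSL2C) (hz : ∀ γ, z * ρ γ = ρ γ * z) : z * z = 1 := by
  obtain ⟨Z, rfl⟩ := proj_surj z
  by_contra hne
  apply hirr
  obtain ⟨v, c, hv, hvc⟩ := exists_eigvec (Z : Matrix (Fin 2) (Fin 2) ℂ)
  refine ⟨v, hv, fun γ M hM => ?_⟩
  have h := hz γ
  rw [← hM] at h
  rcases comm_lift _ _ h with h | h
  · exact eig_of_comm Z M (fun h => hne (by simp [h])) h v c hv hvc
  · exact (hne (invol_of_trace_zero Z (trace_zero_of_anti Z M h))).elim

/-- M4 -/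
theorem exists_third {Γ : Type*} [Group Γ] (ρ : Γ →* PSL2C) (hirr : ¬ IsReducibleRep ρ)
    (u : PSL2C) : ∃ γ, ρ γ ≠ 1 ∧ ρ γ ≠ u := by
  by_contra hcon
  push Not at hcon
  apply hirr
  obtain ⟨U, rfl⟩ := proj_surj u
  obtain ⟨v, c, hv, hvc⟩ := exists_eigvec (U : Matrix (Fin 2) (Fin 2) ℂ)
  refine ⟨v, hv, fun γ M hM => ?_⟩
  by_cases h1 : ρ γ = 1
  · rw [h1, proj_one] at hM
    rcases hM with h | h
    · exact ⟨1, by simp [h]⟩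
    · exact ⟨-1, by simp [h, Matrix.neg_mulVec]⟩
  · rw [hcon γ h1, proj_eq] at hM
    rcases hM with h | h
    · exact ⟨c, by rw [h, hvc]⟩
    · exact ⟨-c, by rw [h, Matrix.neg_mulVec, hvc, neg_smul]⟩

/-- M2 -/
theorem conj_into_NN (z : PSL2C) (h1 : z ≠ 1) (h2 : z * z = 1) :
    ∃ B : PSL2C, ∀ x : PSL2C, x * z = z * x → B * x * B⁻¹ ∈ NNset := by
  obtain ⟨Z, rfl⟩ := proj_surj z
  have ht := trace_zero_of_invol Z h1 h2
  have hdet := det_entries Z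
  rw [ht] at hdet
  have hI : Complex.I * Complex.I = -1 := Complex.I_mul_I
  have ev : ∀ c : ℂ, c * c = -1 → ∃ v : Fin 2 → ℂ, v ≠ 0 ∧
      Z 0 0 * v 0 + Z 0 1 * v 1 = c * v 0 ∧ Z 1 0 * v 0 - Z 0 0 * v 1 = c * v 1 := by
    intro c hc
    have : ((Z : Matrix (Fin 2) (Fin 2) ℂ) - Matrix.scalar (Fin 2) c).det = 0 := by
      rw [Matrix.det_fin_two]
      simp [ht]
      linear_combination hdet + hc
    obtain ⟨v, hv, h⟩ := Matrix.exists_mulVec_eq_zero_iff.2 this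
    refine ⟨v, hv, ?_, ?_⟩
    · have := congrFun h 0
      simp [Matrix.mulVec, dotProduct, Fin.sum_univ_two] at this
      linear_combination this
    · have := congrFun h 1
      simp [Matrix.mulVec, dotProduct, Fin.sum_univ_two, ht] at this
      linear_combination this
  obtain ⟨v, hv, v1, v2⟩ := ev Complex.I hI
  obtain ⟨u, hu, u1, u2⟩ := ev (-Complex.I) (by linear_combination hI)
  have hD : v 0 * u 1 - v 1 * u 0 ≠ 0 := by
    intro h
    obtain ⟨c, hc⟩ := parallel u v hv (sub_eq_zero.1 h)
    apply hu
    have e0 : u 0 = c * v 0 := congrFun hc 0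
    have e1 : u 1 = c * v 1 := congrFun hc 1
    have hI2 : (2 * Complex.I) ≠ 0 := by simp
    ext i; fin_cases i
    · apply (mul_eq_zero.1 (show (2 * Complex.I) * u 0 = 0 by
        rw [e0, e1] at u1; rw [e0]; linear_combination u1 - c * v1)).resolve_left hI2
    · apply (mul_eq_zero.1 (show (2 * Complex.I) * u 1 = 0 by
        rw [e0, e1] at u2; rw [e1]; linear_combination u2 - c * v2)).resolve_left hI2
  set D := v 0 * u 1 - v 1 * u 0 with hDdef
  -- P has columns v / D and u
  let P : SL2C := ⟨!![v 0 / D, u 0; v 1 / D, u 1], by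
    rw [Matrix.det_fin_two_of]; field_simp; rw [hDdef]; ring⟩
  let T : SL2C := ⟨!![Complex.I, 0; 0, -Complex.I], by
    rw [Matrix.det_fin_two_of]; linear_combination -hI⟩
  have hZP : Z * P = P * T := by
    apply Subtype.ext
    rw [mat_eq_iff]
    simp only [Matrix.SpecialLinearGroup.coe_mul, Matrix.mul_apply, Fin.sum_univ_two]
    simp [P, T, ht]
    refine ⟨?_, ?_, ?_, ?_⟩
    · field_simp; linear_combination v1
    · linear_combination u1
    · field_simp; linear_combination v2
    · linear_combination u2
  have hT : T = P⁻¹ * Z * P := by rw [mul_assoc, hZP]; group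
  refine ⟨projPSL P⁻¹, fun x hx => ?_⟩
  obtain ⟨M, rfl⟩ := proj_surj x
  refine ⟨P⁻¹ * M * P, by simp, ?_⟩
  have hc : projPSL (P⁻¹ * M * P) * projPSL T = projPSL T * projPSL (P⁻¹ * M * P) := by
    rw [hT]
    simp only [map_mul, map_inv]
    have : ∀ p : PSL2C, p⁻¹ * projPSL M * p * (p⁻¹ * projPSL Z * p) =
      p⁻¹ * (projPSL M * projPSL Z) * p := fun p => by group
    rw [this, hx]
    group
  set N := P⁻¹ * M * P
  have hI2 : (2 * Complex.I) ≠ 0 := by simp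
  have k : ∀ y : ℂ, (2 * Complex.I) * y = 0 → y = 0 := fun y hy =>
    (mul_eq_zero.1 hy).resolve_left hI2
  rcases comm_lift _ _ hc with h | h
  · left
    rw [mat_eq_iff] at h
    simp only [Matrix.mul_apply, Fin.sum_univ_two, Matrix.neg_apply] at h
    simp [T] at h
    obtain ⟨-, b, c, -⟩ := h
    exact ⟨k _ (by linear_combination -b), k _ (by linear_combination c)⟩
  · right
    rw [mat_eq_iff] at h
    simp only [Matrix.mul_apply, Fin.sum_univ_two, Matrix.neg_apply] at h
    simp [T] at h
    obtain ⟨a, -, -, d⟩ := h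
    exact ⟨k _ (by linear_combination a), k _ (by linear_combination -d)⟩

/-- Matrices commuting with a nonscalar matrix are polynomials in it. -/
theorem comm_poly (Z X : SL2C) (hZ : projPSL Z ≠ 1)
    (h : (X : Matrix (Fin 2) (Fin 2) ℂ) * Z = Z * X) :
    ∃ a b : ℂ, (X : Matrix (Fin 2) (Fin 2) ℂ) = a • (1 : Matrix (Fin 2) (Fin 2) ℂ) + b • (Z : Matrix (Fin 2) (Fin 2) ℂ) := by
  rw [mat_eq_iff] at h
  simp only [Matrix.mul_apply, Fin.sum_univ_two] at h
  obtain ⟨h00, h01, h10, h11⟩ := h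
  have fin : ∀ a b : ℂ, X 0 0 = a + b * Z 0 0 → X 0 1 = b * Z 0 1 → X 1 0 = b * Z 1 0 →
      X 1 1 = a + b * Z 1 1 → ∃ a b : ℂ, (X : Matrix (Fin 2) (Fin 2) ℂ) =
        a • (1 : Matrix (Fin 2) (Fin 2) ℂ) + b • (Z : Matrix (Fin 2) (Fin 2) ℂ) := by
    intro a b p q r s
    refine ⟨a, b, ?_⟩
    rw [mat_eq_iff]
    simp [p, q, r, s]
  by_cases hb : Z 0 1 = 0
  · by_cases hc : Z 1 0 = 0
    · have hd : Z 0 0 - Z 1 1 ≠ 0 := fun h => hZ (proj_one_of_scalar Z hb hc (sub_eq_zero.1 h))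
      rw [hb] at h01
      rw [hc] at h10
      have x01 : X 0 1 = 0 := (mul_eq_zero.1 (show (Z 0 0 - Z 1 1) * X 0 1 = 0 by
        linear_combination -h01)).resolve_left hd
      have x10 : X 1 0 = 0 := (mul_eq_zero.1 (show (Z 0 0 - Z 1 1) * X 1 0 = 0 by
        linear_combination h10)).resolve_left hd
      refine fin (X 0 0 - (X 0 0 - X 1 1) / (Z 0 0 - Z 1 1) * Z 0 0)
        ((X 0 0 - X 1 1) / (Z 0 0 - Z 1 1)) (by ring) (by simp [hb, x01]) (by simp [hc, x10]) ?_
      field_simp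
      ring
    · refine fin (X 0 0 - X 1 0 / Z 1 0 * Z 0 0) (X 1 0 / Z 1 0) (by ring) ?_ ?_ ?_
      · field_simp; linear_combination h00
      · field_simp
      · field_simp; linear_combination h10
  · refine fin (X 0 0 - X 0 1 / Z 0 1 * Z 0 0) (X 0 1 / Z 0 1) (by ring) ?_ ?_ ?_
    · field_simp
    · field_simp; linear_combination -h00
    · field_simp; linear_combination -h01

theorem anti_of_invol (Z W : SL2C) (hz : projPSL Z ≠ 1) (hw : projPSL W ≠ 1)
    (hzw : projPSL W ≠ projPSL Z) (hz2 : projPSL Z * projPSL Z = 1)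
    (hw2 : projPSL W * projPSL W = 1) (h : projPSL W * projPSL Z = projPSL Z * projPSL W) :
    (W : Matrix (Fin 2) (Fin 2) ℂ) * Z = -(Z * W : Matrix (Fin 2) (Fin 2) ℂ) := by
  rcases comm_lift _ _ h with h | h
  · exfalso
    obtain ⟨a, b, hab⟩ := comm_poly Z W hz h
    have tz := trace_zero_of_invol Z hz hz2
    have tw := trace_zero_of_invol W hw hw2
    rw [mat_eq_iff] at hab
    simp at hab
    obtain ⟨p, q, r, s⟩ := hab
    have dz := det_entries Z
    have dw := det_entries W
    have ha : a = 0 := by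
      rw [tz] at s
      linear_combination (tw - p - s) / 2
    subst ha
    rw [p, q, r, s] at dw
    have hb : (b - 1) * (b + 1) = 0 := by linear_combination dw - b ^ 2 * dz
    apply hzw
    rw [proj_eq, mat_eq_iff, mat_eq_iff]
    rcases mul_eq_zero.1 hb with h | h
    · have : b = 1 := by linear_combination h
      left; simp [p, q, r, s, this]
    · have : b = -1 := by linear_combination h
      right; simp [p, q, r, s, this]
  · exact h

theorem one_of_comm_comm (Z W X : SL2C) (hz : projPSL Z ≠ 1)
    (hzw : (W : Matrix (Fin 2) (Fin 2) ℂ) * Z = -(Z * W : Matrix (Fin 2) (Fin 2) ℂ))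
    (hXZ : (X : Matrix (Fin 2) (Fin 2) ℂ) * Z = Z * X)
    (hXW : (X : Matrix (Fin 2) (Fin 2) ℂ) * W = W * X) : projPSL X = 1 := by
  obtain ⟨a, b, hab⟩ := comm_poly Z X hz hXZ
  have hb : b = 0 := by
    rw [hab] at hXW
    have h1 : (2 * b) • ((Z * W : SL2C) : Matrix (Fin 2) (Fin 2) ℂ) = 0 := by
      rw [Matrix.SpecialLinearGroup.coe_mul]
      simp only [add_mul, mul_add, smul_mul_assoc, mul_smul_comm, one_mul, mul_one, hzw,
        smul_neg] at hXW
      have h2 := add_left_cancel hXW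
      rw [two_mul, add_smul]
      nth_rewrite 1 [h2]
      simp
    rcases smul_eq_zero.1 h1 with h | h
    · simpa using h
    · have := (Z * W).2
      rw [h] at this
      simp at this
  rw [hb, mat_eq_iff] at hab
  simp at hab
  obtain ⟨p, q, r, s⟩ := hab
  exact proj_one_of_scalar X q r (by rw [p, s])

/-- M3 -/
theorem klein_centralizer (z w x : PSL2C) (hz : z ≠ 1) (hw : w ≠ 1) (hzw : w ≠ z)
    (hz2 : z * z = 1) (hw2 : w * w = 1) (h : w * z = z * w)
    (hxz : x * z = z * x) (hxw : x * w = w * x) : x = 1 ∨ x = z ∨ x = w ∨ x = z * w := by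
  obtain ⟨Z, rfl⟩ := proj_surj z
  obtain ⟨W, rfl⟩ := proj_surj w
  obtain ⟨X, rfl⟩ := proj_surj x
  have hanti := anti_of_invol Z W hz hw hzw hz2 hw2 h
  have hfin : ∀ Y : SL2C, projPSL Y * projPSL Y = 1 → projPSL (X * Y) = 1 →
      projPSL X = projPSL Y := by
    intro Y h2 h1
    rw [map_mul] at h1
    exact (eq_inv_of_mul_eq_one_left h1).trans (eq_inv_of_mul_eq_one_left h2).symm
  have hone := one_of_comm_comm Z W
  generalize hZ : (Z : Matrix (Fin 2) (Fin 2) ℂ) = Zm at *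
  generalize hW : (W : Matrix (Fin 2) (Fin 2) ℂ) = Wm at *
  rcases comm_lift _ _ hxz with h1 | h1 <;> rcases comm_lift _ _ hxw with h3 | h3 <;>
    rw [hZ] at h1 <;> rw [hW] at h3
  · left
    exact hone X hz hanti h1 h3
  · right; left
    apply hfin Z hz2
    apply hone (X * Z) hz hanti
    · rw [Matrix.SpecialLinearGroup.coe_mul, hZ, h1, mul_assoc, h1]
    · rw [Matrix.SpecialLinearGroup.coe_mul, hZ]
      have : Zm * Wm = -(Wm * Zm) := by rw [hanti, neg_neg]
      rw [mul_assoc, this, mul_neg, ← mul_assoc, h3, neg_mul, neg_neg, mul_assoc]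
  · right; right; left
    apply hfin W hw2
    apply hone (X * W) hz hanti
    · rw [Matrix.SpecialLinearGroup.coe_mul, hW]
      rw [mul_assoc, hanti, mul_neg, ← mul_assoc, h1, neg_mul, neg_neg, mul_assoc]
    · rw [Matrix.SpecialLinearGroup.coe_mul, hW, h3, mul_assoc, h3]
  · right; right; right
    rw [← map_mul]
    apply hfin (Z * W)
    · rw [map_mul, mul_assoc, ← mul_assoc (projPSL W), h, mul_assoc, hw2, mul_one, hz2]
    have : Zm * Wm = -(Wm * Zm) := by rw [hanti, neg_neg]
    apply hone (X * (Z * W)) hz hanti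
    · rw [Matrix.SpecialLinearGroup.coe_mul, Matrix.SpecialLinearGroup.coe_mul, hZ, hW]
      rw [mul_assoc, mul_assoc Zm, hanti, mul_neg, mul_neg, ← mul_assoc, h1]
      simp [mul_assoc]
    · rw [Matrix.SpecialLinearGroup.coe_mul, Matrix.SpecialLinearGroup.coe_mul, hZ, hW]
      generalize (X : Matrix (Fin 2) (Fin 2) ℂ) = Xm at *
      have hWX : Wm * Xm = -(Xm * Wm) := by rw [h3, neg_neg]
      rw [mul_assoc, ← mul_assoc Wm Xm, hWX, neg_mul, mul_assoc Xm Wm, ← mul_assoc Wm Zm, hanti,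
        neg_mul, mul_neg, neg_neg]

theorem centralizer_trivial {Γ : Type*} [Group Γ] (Γ₀ : Subgroup Γ) [hN : Γ₀.Normal]
    (ρ : Γ →* PSL2C) (hstr : IsStrictlyIrreducibleRep ρ)
    (hA4 : ¬ Nonempty (↥ρ.range ≃* alternatingGroup (Fin 4)))
    (hS4 : ¬ Nonempty (↥ρ.range ≃* Equiv.Perm (Fin 4)))
    (hirr : ¬ IsReducibleRep (ρ.comp Γ₀.subtype))
    (z : PSL2C) (hz : ∀ γ ∈ Γ₀, z * ρ γ = ρ γ * z) : z = 1 := by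
  by_contra hz1
  have hsq : ∀ x : PSL2C, (∀ γ ∈ Γ₀, x * ρ γ = ρ γ * x) → x * x = 1 := fun x hx =>
    invol_of_centralize _ hirr x (fun γ => hx γ.1 γ.2)
  have hnocent : ∀ x : PSL2C, x ≠ 1 → x * x = 1 → ¬ ∀ g, ρ g * x = x * ρ g := by
    intro x h1 h2 hx
    obtain ⟨B, hB⟩ := conj_into_NN x h1 h2
    exact hstr.2 B (fun γ => hB _ (hx γ))
  have hz2 := hsq z hz
  by_cases hex : ∃ w : PSL2C, (∀ γ ∈ Γ₀, w * ρ γ = ρ γ * w) ∧ w ≠ 1 ∧ w ≠ z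
  · obtain ⟨w, hw, hw1, hwz⟩ := hex
    have hw2 := hsq w hw
    have hzw2 : (z * w) * (z * w) = 1 := hsq (z * w) (fun γ hγ => by
      rw [mul_assoc, hw γ hγ, ← mul_assoc, hz γ hγ, mul_assoc])
    have hcomm : w * z = z * w := by
      have h1 := eq_inv_of_mul_eq_one_left hzw2
      rw [mul_inv_rev, ← eq_inv_of_mul_eq_one_left hz2, ← eq_inv_of_mul_eq_one_left hw2] at h1
      exact h1.symm
    have hkl : ∀ x : PSL2C, x * z = z * x → x * w = w * x →
        x = 1 ∨ x = z ∨ x = w ∨ x = z * w := fun x h1 h2 =>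
      klein_centralizer z w x hz1 hw1 hwz hz2 hw2 hcomm h1 h2
    have hH : ∀ γ ∈ Γ₀, ρ γ = 1 ∨ ρ γ = z ∨ ρ γ = w ∨ ρ γ = z * w := fun γ hγ =>
      hkl _ (hz γ hγ).symm (hw γ hγ).symm
    obtain ⟨⟨α, hα⟩, ha1, -⟩ := exists_third _ hirr 1
    obtain ⟨⟨β, hβ⟩, hb1, hba⟩ := exists_third _ hirr (ρ α)
    change ρ α ≠ 1 at ha1
    change ρ β ≠ 1 at hb1
    change ρ β ≠ ρ α at hba
    have hzzw : z * (z * w) = w := by rw [← mul_assoc, hz2, one_mul]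
    have hzwz : z * w * z = w := by rw [← hcomm, mul_assoc, hz2, mul_one]
    have hzww : z * w * w = z := by rw [mul_assoc, hw2, mul_one]
    have hwzw : w * (z * w) = z := by rw [← mul_assoc, hcomm, hzww]
    have hmem : (∃ γ ∈ Γ₀, ρ γ = z) ∧ (∃ γ ∈ Γ₀, ρ γ = w) := by
      have hαβ := Γ₀.mul_mem hα hβ
      have hm : ρ (α * β) = ρ α * ρ β := map_mul _ _ _
      rcases hH α hα with h | h | h | h <;> rcases hH β hβ with k | k | k | k <;>
        first
        | exact absurd h ha1
        | exact absurd k hb1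
        | exact absurd (k.trans h.symm) hba
        | skip
      · exact ⟨⟨α, hα, h⟩, ⟨β, hβ, k⟩⟩
      · exact ⟨⟨α, hα, h⟩, ⟨α * β, hαβ, by rw [hm, h, k, hzzw]⟩⟩
      · exact ⟨⟨β, hβ, k⟩, ⟨α, hα, h⟩⟩
      · exact ⟨⟨α * β, hαβ, by rw [hm, h, k, hwzw]⟩, ⟨α, hα, h⟩⟩
      · exact ⟨⟨β, hβ, k⟩, ⟨α * β, hαβ, by rw [hm, h, k, hzwz]⟩⟩
      · exact ⟨⟨α * β, hαβ, by rw [hm, h, k, hzww]⟩, ⟨β, hβ, k⟩⟩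
    obtain ⟨⟨ζ, hζ, rfl⟩, ⟨ω, hω, rfl⟩⟩ := hmem
    have himg : ∀ x : PSL2C, (x = 1 ∨ x = ρ ζ ∨ x = ρ ω ∨ x = ρ ζ * ρ ω) →
        ∃ γ ∈ Γ₀, ρ γ = x := by
      rintro x (rfl | rfl | rfl | rfl)
      · exact ⟨1, Γ₀.one_mem, map_one _⟩
      · exact ⟨ζ, hζ, rfl⟩
      · exact ⟨ω, hω, rfl⟩
      · exact ⟨ζ * ω, Γ₀.mul_mem hζ hω, map_mul _ _ _⟩
    let V : Subgroup ρ.range := Γ₀.map ρ.rangeRestrict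
    have hVN : V.Normal := hN.map _ ρ.rangeRestrict_surjective
    have hV4 : Nat.card V = 4 := by
      rw [Nat.card_congr (V.equivMapOfInjective ρ.range.subtype
        ρ.range.subtype_injective).toEquiv]
      have hset : ((V.map ρ.range.subtype : Subgroup PSL2C) : Set PSL2C) =
          {1, ρ ζ, ρ ω, ρ ζ * ρ ω} := by
        ext x
        simp only [Set.mem_insert_iff, Set.mem_singleton_iff, SetLike.mem_coe]
        constructor
        · rintro ⟨_, ⟨γ, hγ, rfl⟩, rfl⟩
          exact hH γ hγ
        · intro h
          obtain ⟨γ, hγ, rfl⟩ := himg x h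
          exact ⟨_, ⟨γ, hγ, rfl⟩, rfl⟩
      have hn : Nat.card (V.map ρ.range.subtype) =
          Set.ncard ((V.map ρ.range.subtype : Subgroup PSL2C) : Set PSL2C) := rfl
      have hzw1 : ρ ζ * ρ ω ≠ 1 := by
        intro h
        apply hwz
        rw [← hzzw, h, mul_one]
      have e1 : ρ ζ ≠ ρ ζ * ρ ω := by
        intro h; exact hw1 (mul_eq_left.1 h.symm)
      have e2 : ρ ω ≠ ρ ζ * ρ ω := by
        intro h; exact hz1 (mul_eq_right.1 h.symm)
      rw [hn, hset, Set.ncard_insert_of_notMem, Set.ncard_insert_of_notMem, Set.ncard_pair e2]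
      · simp [hwz.symm, e1]
      · simp only [Set.mem_insert_iff, Set.mem_singleton_iff]
        rintro (h | h | h)
        · exact hz1 h.symm
        · exact hw1 h.symm
        · exact hzw1 h.symm
    have h2 : ∀ v ∈ V, v * v = 1 := by
      rintro _ ⟨γ, hγ, rfl⟩
      apply Subtype.ext
      show ρ γ * ρ γ = 1
      rcases hH γ hγ with h | h | h | h <;> rw [h]
      · simp
      · exact hz2
      · exact hw2
      · exact hzw2
    refine (not_or.2 ⟨hA4, hS4⟩) (groupA V hV4 h2 ?_ ?_)
    · intro g hg
      have hgz := congrArg Subtype.val (hg (ρ.rangeRestrict ζ) ⟨ζ, hζ, rfl⟩)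
      have hgw := congrArg Subtype.val (hg (ρ.rangeRestrict ω) ⟨ω, hω, rfl⟩)
      obtain ⟨γ, hγ, h⟩ := himg g.1 (hkl g.1 hgz hgw)
      exact ⟨γ, hγ, Subtype.ext h⟩
    · intro u hu hc
      by_contra hu1
      refine hnocent u.1 (fun h => hu1 (Subtype.ext h)) (congrArg Subtype.val (h2 u hu)) ?_
      intro g
      exact congrArg Subtype.val (hc (ρ.rangeRestrict g))
  · push Not at hex
    apply hnocent z hz1 hz2
    intro g
    rw [← mul_inv_eq_iff_eq_mul]
    apply hex
    · intro γ hγ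
      have h1 := hz _ (hN.conj_mem γ hγ g⁻¹)
      simp only [map_mul, map_inv, inv_inv] at h1
      have h2 := congrArg (fun t => ρ g * t * (ρ g)⁻¹) h1
      simp only [mul_assoc, mul_inv_cancel, mul_one, mul_inv_cancel_left] at h2 ⊢
      exact h2
    · intro h
      rw [mul_inv_eq_one, mul_eq_left] at h
      exact hz1 h

/-- Strictly irreducible representations of `Γ` into `PSL(2,ℂ)` with images not
isomorphic to `A₄` or `S₄` and irreducible conjugate restrictions to a finitely generated normal
subgroup `Γ₀` are themselves conjugate. -/
theorem stmt3 {Γ : Type*} [Group Γ] (hfg : Group.FG Γ) (Γ₀ : Subgroup Γ) [Γ₀.Normal]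
    (hfg₀ : Group.FG ↥Γ₀)
    (ρ₁ ρ₂ : Γ →* PSL2C)
    (hstr₁ : IsStrictlyIrreducibleRep ρ₁) (hstr₂ : IsStrictlyIrreducibleRep ρ₂)
    (hA4₁ : ¬ Nonempty (↥ρ₁.range ≃* alternatingGroup (Fin 4)))
    (hS4₁ : ¬ Nonempty (↥ρ₁.range ≃* Equiv.Perm (Fin 4)))
    (hA4₂ : ¬ Nonempty (↥ρ₂.range ≃* alternatingGroup (Fin 4)))
    (hS4₂ : ¬ Nonempty (↥ρ₂.range ≃* Equiv.Perm (Fin 4)))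
    (hirr₁ : ¬ IsReducibleRep (ρ₁.comp Γ₀.subtype))
    (hirr₂ : ¬ IsReducibleRep (ρ₂.comp Γ₀.subtype))
    (hconj : ∃ B : PSL2C, ∀ γ ∈ Γ₀, ρ₂ γ = B * ρ₁ γ * B⁻¹) :
    ∃ B : PSL2C, ∀ γ : Γ, ρ₂ γ = B * ρ₁ γ * B⁻¹ := by
  obtain ⟨B, hB⟩ := hconj
  refine ⟨B, fun γ => ?_⟩
  have h := centralizer_trivial Γ₀ ρ₁ hstr₁ hA4₁ hS4₁ hirr₁ ((ρ₁ γ)⁻¹ * (B⁻¹ * ρ₂ γ * B)) ?_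
  · rw [inv_mul_eq_one] at h
    rw [h]
    group
  · intro η hη
    have hη' : γ * η * γ⁻¹ ∈ Γ₀ := (inferInstance : Γ₀.Normal).conj_mem η hη γ
    have h1 := hB _ hη'
    have h2 := hB _ hη
    simp only [map_mul, map_inv] at h1
    rw [h2] at h1
    have h3 : ρ₂ γ * B * ρ₁ η = B * ρ₁ γ * ρ₁ η * (ρ₁ γ)⁻¹ * B⁻¹ * ρ₂ γ * B := by
      have := congrArg (fun t => t * ρ₂ γ * B) h1
      simp only [mul_assoc, inv_mul_cancel_left, inv_mul_cancel, mul_one] at this ⊢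
      exact this
    calc (ρ₁ γ)⁻¹ * (B⁻¹ * ρ₂ γ * B) * ρ₁ η = (ρ₁ γ)⁻¹ * B⁻¹ * (ρ₂ γ * B * ρ₁ η) := by group
      _ = _ := by rw [h3]; group
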